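/- Let 𝐅 ∈ Λ'_{q,l} for some q>1, and suppose 𝐅 = ∂̄𝐆 with 𝐆 ∈ Λ'_{q',l'}, q'>1. Set F = ω^{-1}𝐅 and G = ω^{-1}𝐆. If the sesquilinear form 𝐭_F has finite rank on reproducing kernels (equivalently, on analytic polynomials), then so does 𝐭_G, and the rank of 𝐭_G is not greater than the rank of 𝐭_F. In fact 𝐭_F(z^k, z^{k'}) = −k' 𝐭_G(z^k, z^{k'−1}) for all k≥0, k'≥1. -/

import Mathlib

open MeasureTheory Filter Complex Metric

noncomputable section

/-- The Gaussian weight `ω(z) = π⁻¹ exp (-|z|²)`. -/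
def omegaW (z : ℂ) : ℝ := Real.pi⁻¹ * Real.exp (-‖z‖ ^ 2)

/-- Membership in the weighted space `Λ_{q,l}`: `C^l`-smooth functions whose
derivatives up to order `l` are `o(exp (q|z|²))` at infinity. -/
def MemLambda (q : ℝ) (l : ℕ) (ψ : ℂ → ℂ) : Prop :=
  ContDiff ℝ (l : ℕ∞) ψ ∧
    ∀ n : ℕ, n ≤ l →
      Tendsto (fun z : ℂ => ‖iteratedFDeriv ℝ n ψ z‖ * Real.exp (-q * ‖z‖ ^ 2))
        (cocompact ℂ) (nhds 0)

/-- The norm of `Λ_{q,l}`. -/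
def lambdaNorm (q : ℝ) (l : ℕ) (ψ : ℂ → ℂ) : ℝ :=
  sSup {r : ℝ | ∃ n ≤ l, ∃ z : ℂ, r = ‖iteratedFDeriv ℝ n ψ z‖ * Real.exp (-q * ‖z‖ ^ 2)}

/-- Distributions on `ℂ`, encoded by their pairing against test functions
(with respect to Lebesgue measure). -/
abbrev Dst : Type := (ℂ → ℂ) → ℂ

/-- Membership in the dual space `Λ'_{q,l}`. -/
def MemLambdaDual (q : ℝ) (l : ℕ) (T : Dst) : Prop :=
  (∀ ψ φ, MemLambda q l ψ → MemLambda q l φ → T (ψ + φ) = T ψ + T φ) ∧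
  (∀ (c : ℂ) (ψ), MemLambda q l ψ → T (c • ψ) = c * T ψ) ∧
  (∃ C : ℝ, ∀ ψ, MemLambda q l ψ → ‖T ψ‖ ≤ C * lambdaNorm q l ψ)

/-- The dual norm on `Λ'_{q,l}`. -/
def lambdaDualNorm (q : ℝ) (l : ℕ) (T : Dst) : ℝ :=
  sInf {C : ℝ | 0 ≤ C ∧ ∀ ψ, MemLambda q l ψ → ‖T ψ‖ ≤ C * lambdaNorm q l ψ}

/-- `∂̄ = (∂/∂x + i ∂/∂y)/2` of a function. -/
def dbarFun (ψ : ℂ → ℂ) : ℂ → ℂ := fun z =>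
  (fderiv ℝ ψ z 1 + Complex.I * fderiv ℝ ψ z Complex.I) / 2

/-- Membership in `𝔇_q`: smooth functions all of whose derivatives are
`o(exp (q|z|²))`. -/
def MemDq (q : ℝ) (ψ : ℂ → ℂ) : Prop :=
  ContDiff ℝ (⊤ : ℕ∞) ψ ∧
    ∀ n : ℕ,
      Tendsto (fun z : ℂ => ‖iteratedFDeriv ℝ n ψ z‖ * Real.exp (-q * ‖z‖ ^ 2))
        (cocompact ℂ) (nhds 0)

/-- Membership in the dual space `𝔇'_q`; every such distribution has finite
order, i.e. is bounded by some `Λ_{q,l}`-norm. -/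
def MemDqDual (q : ℝ) (T : Dst) : Prop :=
  (∀ ψ φ, MemDq q ψ → MemDq q φ → T (ψ + φ) = T ψ + T φ) ∧
  (∀ (c : ℂ) (ψ), MemDq q ψ → T (c • ψ) = c * T ψ) ∧
  (∃ (l : ℕ) (C : ℝ), ∀ ψ, MemDq q ψ → ‖T ψ‖ ≤ C * lambdaNorm q l ψ)

/-- Membership in the Fock space `𝓑`: entire and square integrable against `ω dλ`. -/
def MemFock (u : ℂ → ℂ) : Prop :=
  Differentiable ℂ u ∧ Integrable (fun z : ℂ => ‖u z‖ ^ 2 * omegaW z)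

/-- The Fock norm. -/
def fockNorm (u : ℂ → ℂ) : ℝ := Real.sqrt (∫ z : ℂ, ‖u z‖ ^ 2 * omegaW z)

/-- The Fock (weighted `L²`) inner product `(u,v) = ∫ u v̄ ω dλ`. -/
def fockInner (u v : ℂ → ℂ) : ℂ := ∫ z : ℂ, u z * (starRingEnd ℂ) (v z) * (omegaW z : ℂ)

/-- The reproducing kernel `κ_z(w) = exp (w z̄)`. -/
def repKer (z : ℂ) : ℂ → ℂ := fun w => Complex.exp (w * (starRingEnd ℂ) z)

/-- The Toeplitz sesquilinear form `𝐭_F(u,v) = ⟨ωF, u v̄⟩`, expressed through the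
distribution `T = 𝐅 = ωF`. -/
def toeplitzForm (T : Dst) (u v : ℂ → ℂ) : ℂ := T fun z => u z * (starRingEnd ℂ) (v z)

/-- An infinite matrix has rank at most `N` iff every finite submatrix does. -/
def InfRankLE (A : ℕ → ℕ → ℂ) (N : ℕ) : Prop :=
  ∀ (m : ℕ) (r c : Fin m → ℕ), (Matrix.of fun i j : Fin m => A (r i) (c j)).rank ≤ N

/-- The matrix `𝔓(F)` with entries `𝐭_F(z^k, z^{k'})`. -/
def matP (T : Dst) : ℕ → ℕ → ℂ :=
  fun k k' => toeplitzForm T (fun z => z ^ k) (fun z => z ^ k')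

/-- The matrix `𝔎(F)` attached to a sequence of points, with entries
`𝐭_F(κ_{z_k}, κ_{z_{k'}})`. -/
def matK (T : Dst) (zs : ℕ → ℂ) : ℕ → ℕ → ℂ :=
  fun k k' => toeplitzForm T (repKer (zs k)) (repKer (zs k'))

/-- The scaling `S_t ψ (z) = t ψ(tz)`. -/
def scaleS (t : ℝ) (ψ : ℂ → ℂ) : ℂ → ℂ := fun z => (t : ℂ) * ψ ((t : ℂ) * z)

/-- The scaling `W_t` on distributions, `⟨W_t 𝐅, ψ⟩ = ⟨𝐅, S_{t⁻¹} ψ⟩`. -/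
def scaleW (t : ℝ) (T : Dst) : Dst := fun ψ => T (scaleS t⁻¹ ψ)

/-- Membership in `𝔇_{1,-}`: `|f(z)| = O(exp (|z|² - a|z|))` for every `a > 0`. -/
def MemD1Minus (f : ℂ → ℂ) : Prop :=
  ∀ a : ℝ, 0 < a → ∃ b : ℝ, ∀ z : ℂ, ‖f z‖ ≤ b * Real.exp (‖z‖ ^ 2 - a * ‖z‖)

/-- The sesquilinear form of the symbol with distribution `T = ωF` has finite rank
(at most `N`) on reproducing kernels, with factors in `𝓑° = 𝓐 ∩ 𝔇_{1,-}`. -/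
def FiniteRankOnKernels (T : Dst) (N : ℕ) : Prop :=
  ∃ f g : Fin N → ℂ → ℂ,
    (∀ j, Differentiable ℂ (f j) ∧ MemD1Minus (f j)) ∧
    (∀ j, Differentiable ℂ (g j) ∧ MemD1Minus (g j)) ∧
    ∀ z z' : ℂ, toeplitzForm T (repKer z) (repKer z') =
      ∑ j : Fin N, fockInner (repKer z) (g j) * fockInner (f j) (repKer z')

/-- Smooth functions all of whose real derivatives have at most exponential growth. -/
def HasExpGrowth (ψ : ℂ → ℂ) : Prop :=
  ContDiff ℝ (⊤ : ℕ∞) ψ ∧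
    ∀ n : ℕ, ∃ C a : ℝ, ∀ m ≤ n, ∀ w : ℂ, ‖iteratedFDeriv ℝ m ψ w‖ ≤ C * Real.exp (a * ‖w‖)

lemma sum_choose_mul_le {n : ℕ} {x y : ℕ → ℝ} {B D : ℝ} (hy0 : ∀ i, 0 ≤ y i)
    (hx : ∀ i ≤ n, x i ≤ B) (hy : ∀ i ≤ n, y i ≤ D) (hB : 0 ≤ B) :
    ∑ i ∈ Finset.range (n + 1), (n.choose i : ℝ) * x i * y (n - i) ≤ 2 ^ n * (B * D) := by
  calc ∑ i ∈ Finset.range (n + 1), (n.choose i : ℝ) * x i * y (n - i)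
      ≤ ∑ i ∈ Finset.range (n + 1), (n.choose i : ℝ) * (B * D) := by
        refine Finset.sum_le_sum fun i hi => ?_
        rw [mul_assoc]
        refine mul_le_mul_of_nonneg_left ?_ (Nat.cast_nonneg _)
        exact mul_le_mul (hx i (by simpa [Nat.lt_succ_iff] using hi)) (hy _ (Nat.sub_le _ _))
          (hy0 _) hB
    _ = 2 ^ n * (B * D) := by
        rw [← Finset.sum_mul]
        congr 1
        exact_mod_cast Nat.sum_range_choose n

lemma HasExpGrowth.mul {ψ φ : ℂ → ℂ} (hψ : HasExpGrowth ψ) (hφ : HasExpGrowth φ) :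
    HasExpGrowth fun w => ψ w * φ w := by
  refine ⟨hψ.1.mul hφ.1, fun n => ?_⟩
  obtain ⟨C, a, h⟩ := hψ.2 n
  obtain ⟨D, b, h'⟩ := hφ.2 n
  refine ⟨2 ^ n * (C * D), a + b, fun m hm w => ?_⟩
  have hB : 0 ≤ C * Real.exp (a * ‖w‖) := (norm_nonneg _).trans (h 0 (Nat.zero_le _) w)
  have hD : 0 ≤ D * Real.exp (b * ‖w‖) := (norm_nonneg _).trans (h' 0 (Nat.zero_le _) w)
  calc ‖iteratedFDeriv ℝ m (fun w => ψ w * φ w) w‖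
      ≤ _ := norm_iteratedFDeriv_mul_le hψ.1 hφ.1 w (by exact_mod_cast le_top)
    _ ≤ 2 ^ m * (C * Real.exp (a * ‖w‖) * (D * Real.exp (b * ‖w‖))) :=
        sum_choose_mul_le (x := fun i => ‖iteratedFDeriv ℝ i ψ w‖)
          (y := fun i => ‖iteratedFDeriv ℝ i φ w‖) (fun _ => norm_nonneg _)
          (fun i hi => h i (hi.trans hm) w) (fun i hi => h' i (hi.trans hm) w) hB
    _ ≤ 2 ^ n * (C * Real.exp (a * ‖w‖) * (D * Real.exp (b * ‖w‖))) := by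
        gcongr
        norm_num
    _ = 2 ^ n * (C * D) * Real.exp ((a + b) * ‖w‖) := by
        rw [add_mul, Real.exp_add]; ring

lemma hasExpGrowth_one : HasExpGrowth fun _ => 1 := by
  refine ⟨contDiff_const, fun n => ⟨1, 0, fun m _ w => ?_⟩⟩
  rcases eq_or_ne m 0 with rfl | hm
  · simp
  · simp [iteratedFDeriv_const_of_ne hm]

lemma HasExpGrowth.pow {ψ : ℂ → ℂ} (hψ : HasExpGrowth ψ) (k : ℕ) :
    HasExpGrowth fun w => ψ w ^ k := by
  induction k with
  | zero => simpa using hasExpGrowth_one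
  | succ k ih => simpa only [pow_succ] using ih.mul hψ

lemma hasExpGrowth_clm (L : ℂ →L[ℝ] ℂ) : HasExpGrowth L := by
  refine ⟨L.contDiff, fun n => ⟨‖L‖, 1, fun m _ w => ?_⟩⟩
  rcases m with _ | m
  · rw [norm_iteratedFDeriv_zero, one_mul]
    refine (L.le_opNorm w).trans (mul_le_mul_of_nonneg_left ?_ (norm_nonneg _))
    linarith [Real.add_one_le_exp ‖w‖]
  · have h1 : (1 : ℝ) ≤ Real.exp (1 * ‖w‖) := Real.one_le_exp (by positivity)
    have hL : fderiv ℝ L = fun _ => L := by ext1 x; exact L.fderiv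
    rw [← norm_iteratedFDeriv_fderiv, hL]
    rcases eq_or_ne m 0 with rfl | hm
    · rw [norm_iteratedFDeriv_zero]
      exact le_mul_of_one_le_right (norm_nonneg _) h1
    · rw [iteratedFDeriv_const_of_ne hm]
      simp only [Pi.zero_apply, norm_zero]
      positivity

lemma contDiff_cexp_clm (L : ℂ →L[ℝ] ℂ) (n : WithTop ℕ∞) :
    ContDiff ℝ n fun w => Complex.exp (L w) :=
  L.contDiff.cexp

lemma fderiv_cexp_clm (L : ℂ →L[ℝ] ℂ) :
    fderiv ℝ (fun w => Complex.exp (L w)) = fun w => Complex.exp (L w) • L := by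
  ext1 w
  exact (L.hasFDerivAt.cexp).fderiv

lemma norm_iteratedFDeriv_cexp_clm_le (L : ℂ →L[ℝ] ℂ) (n : ℕ) (w : ℂ) :
    ‖iteratedFDeriv ℝ n (fun w => Complex.exp (L w)) w‖ ≤ ‖L‖ ^ n * Real.exp (‖L‖ * ‖w‖) := by
  induction n with
  | zero =>
    rw [norm_iteratedFDeriv_zero, pow_zero, one_mul]
    exact (Complex.norm_exp_le_exp_norm _).trans (Real.exp_le_exp.mpr (L.le_opNorm w))
  | succ n ih =>
    let B : ℂ →L[ℝ] (ℂ →L[ℝ] ℂ) := (ContinuousLinearMap.id ℝ ℂ).smulRight L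
    have hB : ‖B‖ ≤ ‖L‖ :=
      B.opNorm_le_bound (norm_nonneg _) fun x => by
        change ‖x • L‖ ≤ _
        rw [norm_smul, mul_comm]
    rw [← norm_iteratedFDeriv_fderiv, fderiv_cexp_clm]
    calc ‖iteratedFDeriv ℝ n (B ∘ fun w => Complex.exp (L w)) w‖
        ≤ ‖B‖ * ‖iteratedFDeriv ℝ n (fun w => Complex.exp (L w)) w‖ :=
          B.norm_iteratedFDeriv_comp_left (contDiff_cexp_clm L n).contDiffAt le_rfl
      _ ≤ ‖L‖ * (‖L‖ ^ n * Real.exp (‖L‖ * ‖w‖)) := by gcongr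
      _ = ‖L‖ ^ (n + 1) * Real.exp (‖L‖ * ‖w‖) := by ring

lemma norm_iteratedFDeriv_cexp_clm_le_of_le (L : ℂ →L[ℝ] ℂ) {m n : ℕ} (hm : m ≤ n) (w : ℂ) :
    ‖iteratedFDeriv ℝ m (fun w => Complex.exp (L w)) w‖ ≤
      (1 + ‖L‖) ^ n * Real.exp (‖L‖ * ‖w‖) := by
  refine (norm_iteratedFDeriv_cexp_clm_le L m w).trans ?_
  gcongr
  calc ‖L‖ ^ m ≤ (1 + ‖L‖) ^ m := by gcongr; linarith
    _ ≤ (1 + ‖L‖) ^ n := pow_le_pow_right₀ (by linarith [norm_nonneg L]) hm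

lemma hasExpGrowth_cexp_clm (L : ℂ →L[ℝ] ℂ) : HasExpGrowth fun w => Complex.exp (L w) :=
  ⟨contDiff_cexp_clm L _, fun n =>
    ⟨(1 + ‖L‖) ^ n, ‖L‖, fun _ hm w => norm_iteratedFDeriv_cexp_clm_le_of_le L hm w⟩⟩

lemma norm_iteratedFDeriv_cexp_clm_sub_one_le (L : ℂ →L[ℝ] ℂ) (hL : ‖L‖ ≤ 1) (n : ℕ) (w : ℂ) :
    ‖iteratedFDeriv ℝ n (fun w => Complex.exp (L w) - 1) w‖ ≤ ‖L‖ * Real.exp (2 * ‖w‖) := by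
  have hLw : ‖L w‖ ≤ ‖L‖ * ‖w‖ := L.le_opNorm w
  have hLw' : ‖L w‖ ≤ ‖w‖ := hLw.trans (mul_le_of_le_one_left (norm_nonneg _) hL)
  rcases n with _ | n
  · rw [norm_iteratedFDeriv_zero]
    have h := Complex.norm_exp_sub_sum_le_norm_mul_exp (L w) 1
    simp only [Finset.sum_range_one, pow_zero, Nat.factorial_zero, Nat.cast_one, div_one,
      pow_one] at h
    calc ‖Complex.exp (L w) - 1‖ ≤ ‖L w‖ * Real.exp ‖L w‖ := h
      _ ≤ (‖L‖ * Real.exp ‖w‖) * Real.exp ‖w‖ := by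
        gcongr
        refine hLw.trans ?_
        gcongr
        linarith [Real.add_one_le_exp ‖w‖]
      _ = ‖L‖ * Real.exp (2 * ‖w‖) := by rw [two_mul, Real.exp_add]; ring
  · have hfd : fderiv ℝ (fun w => Complex.exp (L w) - 1) =
        fderiv ℝ (fun w => Complex.exp (L w)) := by
      ext1 x; exact fderiv_sub_const _
    rw [← norm_iteratedFDeriv_fderiv, hfd, norm_iteratedFDeriv_fderiv]
    refine (norm_iteratedFDeriv_cexp_clm_le L (n + 1) w).trans ?_
    have h1 : ‖L‖ ^ (n + 1) ≤ ‖L‖ := pow_le_of_le_one (norm_nonneg _) hL (by simp)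
    gcongr
    linarith

lemma HasExpGrowth.memDq {ψ : ℂ → ℂ} (hψ : HasExpGrowth ψ) {q : ℝ} (hq : 0 < q) :
    MemDq q ψ := by
  refine ⟨hψ.1, fun n => ?_⟩
  obtain ⟨C, a, h⟩ := hψ.2 n
  have hlim : Tendsto (fun x : ℝ => C * Real.exp (-(x * (q * x - a)))) atTop (nhds 0) := by
    rw [← mul_zero C]
    refine tendsto_const_nhds.mul (Real.tendsto_exp_neg_atTop_nhds_zero.comp ?_)
    refine tendsto_id.atTop_mul_atTop₀ ?_
    exact tendsto_atTop_add_const_right _ (-a) (tendsto_id.const_mul_atTop hq)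
  refine squeeze_zero (fun z => by positivity) (fun z => ?_)
    (hlim.comp (tendsto_norm_cocompact_atTop (E := ℂ)))
  calc ‖iteratedFDeriv ℝ n ψ z‖ * Real.exp (-q * ‖z‖ ^ 2)
      ≤ C * Real.exp (a * ‖z‖) * Real.exp (-q * ‖z‖ ^ 2) := by
        gcongr
        exact h n le_rfl z
    _ = C * Real.exp (-(‖z‖ * (q * ‖z‖ - a))) := by
        rw [mul_assoc, ← Real.exp_add]; congr 2; ring

lemma MemDq.memLambda {q : ℝ} {ψ : ℂ → ℂ} (hψ : MemDq q ψ) (l : ℕ) : MemLambda q l ψ :=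
  ⟨hψ.1.of_le (by exact_mod_cast le_top), fun n _ => hψ.2 n⟩

lemma HasExpGrowth.memLambda {ψ : ℂ → ℂ} (hψ : HasExpGrowth ψ) {q : ℝ} (hq : 0 < q) (l : ℕ) :
    MemLambda q l ψ :=
  (hψ.memDq hq).memLambda l

/-- The multiplication `w ↦ s w` as a real-linear map. -/
def mulCLM (s : ℂ) : ℂ →L[ℝ] ℂ := s • ContinuousLinearMap.id ℝ ℂ

/-- The antilinear multiplication `w ↦ t w̄` as a real-linear map. -/
def conjMulCLM (t : ℂ) : ℂ →L[ℝ] ℂ := t • (Complex.conjCLE : ℂ →L[ℝ] ℂ)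

lemma mulCLM_apply (s w : ℂ) : mulCLM s w = w * s := mul_comm s w

lemma conjMulCLM_apply (t w : ℂ) : conjMulCLM t w = starRingEnd ℂ w * t :=
  mul_comm t (starRingEnd ℂ w)

lemma norm_conjMulCLM (t : ℂ) : ‖conjMulCLM t‖ = ‖t‖ := by
  rw [conjMulCLM, norm_smul, Complex.conjCLE_norm, mul_one]

lemma hasExpGrowth_exp_mul_exp (s t : ℂ) :
    HasExpGrowth fun w => Complex.exp (w * s) * Complex.exp (starRingEnd ℂ w * t) := by
  simpa only [mulCLM_apply, conjMulCLM_apply] using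
    (hasExpGrowth_cexp_clm (mulCLM s)).mul (hasExpGrowth_cexp_clm (conjMulCLM t))

lemma hasExpGrowth_monomial (k k' : ℕ) :
    HasExpGrowth fun w : ℂ => w ^ k * starRingEnd ℂ w ^ k' := by
  simpa only [mulCLM_apply, conjMulCLM_apply, mul_one] using
    ((hasExpGrowth_clm (mulCLM 1)).pow k).mul ((hasExpGrowth_clm (conjMulCLM 1)).pow k')

lemma lambdaNorm_nonneg (q : ℝ) (l : ℕ) (ψ : ℂ → ℂ) : 0 ≤ lambdaNorm q l ψ := by
  refine Real.sSup_nonneg ?_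
  rintro _ ⟨n, -, z, rfl⟩
  positivity

lemma lambdaNorm_exp_mul_exp_sub_one_le {q : ℝ} (hq : 1 < q) (l : ℕ) (s : ℂ) :
    ∃ K : ℝ, ∀ t : ℂ, ‖t‖ ≤ 1 →
      lambdaNorm q l (fun w => Complex.exp (w * s) * (Complex.exp (starRingEnd ℂ w * t) - 1)) ≤
        K * ‖t‖ := by
  set a : ℝ := ‖mulCLM s‖ + 2 with ha
  refine ⟨2 ^ l * (1 + ‖mulCLM s‖) ^ l * Real.exp (a ^ 2), fun t ht => ?_⟩
  refine Real.sSup_le ?_ (by positivity)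
  rintro _ ⟨n, hn, z, rfl⟩
  have hexp : Real.exp (‖mulCLM s‖ * ‖z‖) * Real.exp (2 * ‖z‖) * Real.exp (-q * ‖z‖ ^ 2) ≤
      Real.exp (a ^ 2) := by
    rw [← Real.exp_add, ← Real.exp_add, Real.exp_le_exp, ← add_mul, ← ha]
    nlinarith [sq_nonneg (a - ‖z‖), sq_nonneg ‖z‖, sq_nonneg a]
  have hD : ‖iteratedFDeriv ℝ n
      (fun w => Complex.exp (mulCLM s w) * (Complex.exp (conjMulCLM t w) - 1)) z‖ ≤
      2 ^ n * ((1 + ‖mulCLM s‖) ^ n * Real.exp (‖mulCLM s‖ * ‖z‖) *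
        (‖t‖ * Real.exp (2 * ‖z‖))) := by
    refine (norm_iteratedFDeriv_mul_le (contDiff_cexp_clm (mulCLM s) n)
      ((contDiff_cexp_clm (conjMulCLM t) n).sub contDiff_const) z le_rfl).trans ?_
    refine sum_choose_mul_le
      (x := fun i => ‖iteratedFDeriv ℝ i (fun w => Complex.exp (mulCLM s w)) z‖)
      (y := fun i => ‖iteratedFDeriv ℝ i (fun w => Complex.exp (conjMulCLM t w) - 1) z‖)
      (fun _ => norm_nonneg _)
      (fun i hi => norm_iteratedFDeriv_cexp_clm_le_of_le _ hi z) (fun i _ => ?_) (by positivity)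
    rw [← norm_conjMulCLM t]
    exact norm_iteratedFDeriv_cexp_clm_sub_one_le _ (by rwa [norm_conjMulCLM]) i z
  simp only [mulCLM_apply, conjMulCLM_apply] at hD
  calc _ ≤ 2 ^ n * ((1 + ‖mulCLM s‖) ^ n * Real.exp (‖mulCLM s‖ * ‖z‖) *
        (‖t‖ * Real.exp (2 * ‖z‖))) * Real.exp (-q * ‖z‖ ^ 2) := by gcongr
    _ = 2 ^ n * (1 + ‖mulCLM s‖) ^ n * (Real.exp (‖mulCLM s‖ * ‖z‖) * Real.exp (2 * ‖z‖) *
        Real.exp (-q * ‖z‖ ^ 2)) * ‖t‖ := by ring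
    _ ≤ 2 ^ l * (1 + ‖mulCLM s‖) ^ l * Real.exp (a ^ 2) * ‖t‖ := by
        have h1 : (1 : ℝ) ≤ 1 + ‖mulCLM s‖ := by linarith [norm_nonneg (mulCLM s)]
        gcongr
        norm_num

lemma MemLambdaDual.tendsto_exp_mul_exp {q : ℝ} (hq : 1 < q) {l : ℕ} {T : Dst}
    (hT : MemLambdaDual q l T) (s : ℂ) :
    Tendsto (fun t : ℂ => T fun w => Complex.exp (w * s) * Complex.exp (starRingEnd ℂ w * t))
      (nhds 0)
      (nhds (T fun w => Complex.exp (w * s) * Complex.exp (starRingEnd ℂ w * 0))) := by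
  have hq0 : 0 < q := zero_lt_one.trans hq
  obtain ⟨hadd, hsmul, C, hC⟩ := hT
  obtain ⟨K, hK⟩ := lambdaNorm_exp_mul_exp_sub_one_le hq l s
  have mem : ∀ t, MemLambda q l
      fun w => Complex.exp (w * s) * Complex.exp (starRingEnd ℂ w * t) :=
    fun t => (hasExpGrowth_exp_mul_exp s t).memLambda hq0 l
  have mem_sub : ∀ t : ℂ, ‖t‖ ≤ 1 → MemLambda q l
      fun w => Complex.exp (w * s) * (Complex.exp (starRingEnd ℂ w * t) - 1) := by
    intro t ht
    refine HasExpGrowth.memLambda ?_ hq0 l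
    have hg : HasExpGrowth fun w => Complex.exp (conjMulCLM t w) - 1 :=
      ⟨(contDiff_cexp_clm _ _).sub contDiff_const, fun _ => ⟨‖conjMulCLM t‖, 2, fun m _ w =>
        norm_iteratedFDeriv_cexp_clm_sub_one_le _ (by rwa [norm_conjMulCLM]) m w⟩⟩
    simpa only [mulCLM_apply, conjMulCLM_apply] using
      (hasExpGrowth_cexp_clm (mulCLM s)).mul hg
  rw [tendsto_iff_norm_sub_tendsto_zero]
  have hlim : Tendsto (fun t : ℂ => |C| * (K * ‖t‖)) (nhds 0) (nhds 0) := by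
    have : Continuous fun t : ℂ => |C| * (K * ‖t‖) := by fun_prop
    simpa using this.tendsto 0
  refine squeeze_zero' (Eventually.of_forall fun _ => norm_nonneg _) ?_ hlim
  filter_upwards [Metric.closedBall_mem_nhds (0 : ℂ) one_pos] with t ht
  have ht1 : ‖t‖ ≤ 1 := by simpa using ht
  have hsplit : (fun w => Complex.exp (w * s) * Complex.exp (starRingEnd ℂ w * t)) =
      (fun w => Complex.exp (w * s) * (Complex.exp (starRingEnd ℂ w * t) - 1)) +
        fun w => Complex.exp (w * s) * Complex.exp (starRingEnd ℂ w * 0) := by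
    ext w
    simp only [Pi.add_apply, mul_zero, Complex.exp_zero]
    ring
  rw [hsplit, hadd _ _ (mem_sub t ht1) (mem 0), add_sub_cancel_right]
  calc _ ≤ C * lambdaNorm q l _ := hC _ (mem_sub t ht1)
    _ ≤ |C| * lambdaNorm q l _ :=
        mul_le_mul_of_nonneg_right (le_abs_self C) (lambdaNorm_nonneg _ _ _)
    _ ≤ |C| * (K * ‖t‖) := by gcongr; exact hK t ht1

lemma dbarFun_mul_comp_conj {u h u' h' : ℂ → ℂ} (hu : ∀ z, HasDerivAt u (u' z) z)
    (hh : ∀ z, HasDerivAt h (h' z) z) :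
    dbarFun (fun z => u z * h (starRingEnd ℂ z)) = fun z => u z * h' (starRingEnd ℂ z) := by
  ext z
  have h1 : HasFDerivAt u (u' z • (1 : ℂ →L[ℝ] ℂ)) z := (hu z).complexToReal_fderiv
  have h2 : HasFDerivAt (fun z => h (starRingEnd ℂ z))
      ((h' (starRingEnd ℂ z) • (1 : ℂ →L[ℝ] ℂ)).comp (Complex.conjCLE : ℂ →L[ℝ] ℂ)) z :=
    (hh (starRingEnd ℂ z)).complexToReal_fderiv.comp z Complex.conjCLE.hasFDerivAt
  have h3 : fderiv ℝ (fun z => u z * h (starRingEnd ℂ z)) z = _ := (h1.mul h2).fderiv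
  simp only [dbarFun, h3]
  simp
  linear_combination
    (u' z * h (starRingEnd ℂ z) - u z * h' (starRingEnd ℂ z)) / 2 * Complex.I_mul_I

lemma dbarFun_exp_mul_exp (s t : ℂ) :
    dbarFun (fun w => Complex.exp (w * s) * Complex.exp (starRingEnd ℂ w * t)) =
      t • fun w => Complex.exp (w * s) * Complex.exp (starRingEnd ℂ w * t) := by
  rw [dbarFun_mul_comp_conj (u := fun w => Complex.exp (w * s))
    (h := fun w => Complex.exp (w * t))
    (fun z => ((hasDerivAt_id z).mul_const s).cexp) (fun z => ((hasDerivAt_id z).mul_const t).cexp)]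
  ext w
  simp only [Pi.smul_apply, smul_eq_mul, id, one_mul]
  ring

lemma dbarFun_monomial (k k' : ℕ) :
    dbarFun (fun w => w ^ k * starRingEnd ℂ w ^ k') =
      (k' : ℂ) • fun w => w ^ k * starRingEnd ℂ w ^ (k' - 1) := by
  rw [dbarFun_mul_comp_conj (u := fun w => w ^ k) (h := fun w => w ^ k')
    (fun z => hasDerivAt_pow k z) (fun z => hasDerivAt_pow k' z)]
  ext w
  simp only [Pi.smul_apply, smul_eq_mul]
  ring

lemma integrable_exp_neg_norm : Integrable fun v : ℂ => Real.exp (-‖v‖) := by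
  have h3 : Integrable fun v : ℂ => 27 * (1 + ‖v‖) ^ (-3 : ℝ) :=
    (integrable_one_add_norm (by rw [Complex.finrank_real_complex]; norm_num)).const_mul _
  refine h3.mono' (by fun_prop) (Eventually.of_forall fun v => ?_)
  have hpos : 0 < 1 + ‖v‖ := by positivity
  have hcube : (1 + ‖v‖) ^ 3 ≤ 27 * Real.exp ‖v‖ := by
    have h : 1 + ‖v‖ ≤ 3 * Real.exp (‖v‖ / 3) := by
      linarith [Real.add_one_le_exp (‖v‖ / 3)]
    calc (1 + ‖v‖) ^ 3 ≤ (3 * Real.exp (‖v‖ / 3)) ^ 3 := by gcongr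
      _ = 27 * Real.exp ‖v‖ := by
        rw [mul_pow, ← Real.exp_nat_mul]
        norm_num
        ring
  rw [Real.norm_of_nonneg (Real.exp_nonneg _), Real.rpow_neg hpos.le,
    show (3 : ℝ) = ((3 : ℕ) : ℝ) by norm_num, Real.rpow_natCast, Real.exp_neg,
    ← div_eq_mul_inv, le_div_iff₀ (by positivity), ← div_eq_inv_mul, div_le_iff₀ (Real.exp_pos _)]
  exact hcube

lemma omegaW_pos (z : ℂ) : 0 < omegaW z := by
  unfold omegaW
  positivity

lemma continuous_omegaW : Continuous omegaW := by
  unfold omegaW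
  fun_prop

lemma integral_omegaW : ∫ z : ℂ, omegaW z = 1 := by
  have h := GaussianFourier.integral_rexp_neg_mul_sq_norm (V := ℂ) one_pos
  simp only [neg_one_mul, Complex.finrank_real_complex, div_one] at h
  simp only [omegaW, integral_const_mul, h]
  norm_num [Real.pi_ne_zero]

lemma circleMap_zero_one_mul_norm (θ : ℝ) (v : ℂ) : ‖circleMap 0 1 θ * v‖ = ‖v‖ := by
  rw [norm_mul, norm_circleMap_zero, abs_one, one_mul]

/-- The Gaussian mean value property of entire functions. -/
lemma integral_mul_omegaW_of_entire {g : ℂ → ℂ} (hg : Differentiable ℂ g) {C : ℝ}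
    (hC : ∀ v, ‖g v‖ * omegaW v ≤ C * Real.exp (-‖v‖)) :
    ∫ v : ℂ, g v * (omegaW v : ℂ) = g 0 := by
  have hrot : ∀ θ : ℝ, ∫ v : ℂ, g (circleMap 0 1 θ * v) * (omegaW v : ℂ) =
      ∫ v : ℂ, g v * (omegaW v : ℂ) := by
    intro θ
    have h := (rotation (Circle.exp θ)).measurePreserving.integral_comp
      (rotation (Circle.exp θ)).toHomeomorph.measurableEmbedding
      (fun v : ℂ => g v * (omegaW v : ℂ))
    rw [← h]
    refine integral_congr_ae (Eventually.of_forall fun v => ?_)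
    have hv : rotation (Circle.exp θ) v = circleMap 0 1 θ * v := by
      simp [rotation_apply, circleMap]
    simp only [hv, omegaW, circleMap_zero_one_mul_norm]
  have hmean : ∀ v : ℂ, ∫ θ in (0 : ℝ)..2 * Real.pi, g (circleMap 0 1 θ * v) =
      (2 * Real.pi : ℝ) • g 0 := by
    intro v
    have hd : Differentiable ℂ fun u : ℂ => g (u * v) := by fun_prop
    have h := hd.diffContOnCl.circleAverage (R := 1) (c := 0)
    rw [Real.circleAverage_def, zero_mul] at h
    rw [← h, smul_inv_smul₀ (by positivity)]
  have hint : Integrable (Function.uncurry fun (θ : ℝ) (v : ℂ) =>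
      g (circleMap 0 1 θ * v) * (omegaW v : ℂ))
      ((volume.restrict (Set.Ioc 0 (2 * Real.pi))).prod volume) := by
    refine ((integrable_exp_neg_norm.const_mul C).comp_snd _).mono' ?_
      (Eventually.of_forall fun p => ?_)
    · refine Continuous.aestronglyMeasurable ?_
      have := hg.continuous
      have := continuous_omegaW
      have := continuous_circleMap (0 : ℂ) 1
      simp only [Function.uncurry_def]
      fun_prop
    · have h := hC (circleMap 0 1 p.1 * p.2)
      have hω : omegaW (circleMap 0 1 p.1 * p.2) = omegaW p.2 := by
        simp only [omegaW, circleMap_zero_one_mul_norm]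
      rw [circleMap_zero_one_mul_norm, hω] at h
      rwa [Function.uncurry, norm_mul, Complex.norm_real, Real.norm_of_nonneg (omegaW_pos p.2).le]
  have hpi : (0 : ℝ) ≤ 2 * Real.pi := by positivity
  have hswap := integral_integral_swap hint
  simp only [hrot, ← intervalIntegral.integral_of_le hpi,
    intervalIntegral.integral_mul_const, hmean] at hswap
  have homega : ∫ v : ℂ, (omegaW v : ℂ) = 1 := by
    rw [integral_complex_ofReal, integral_omegaW, Complex.ofReal_one]
  rw [integral_const_mul, homega, mul_one, intervalIntegral.integral_const, sub_zero] at hswap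
  exact smul_right_injective ℂ (by positivity : (2 * Real.pi : ℝ) ≠ 0) hswap

/-- The reproducing property of the kernels, for entire functions in `𝔇_{1,-}`. -/
lemma fockInner_repKer {f : ℂ → ℂ} (hf : Differentiable ℂ f) (hf' : MemD1Minus f) (z : ℂ) :
    fockInner f (repKer z) = f z := by
  obtain ⟨b, hb⟩ := hf' (3 * ‖z‖ + 1) (by positivity)
  have hb0 : 0 ≤ b := by
    have h := (norm_nonneg _).trans (hb 0)
    exact nonneg_of_mul_nonneg_left h (Real.exp_pos _)
  set g : ℂ → ℂ := fun v => f (v + z) * Complex.exp (-(starRingEnd ℂ z * v)) with hg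
  have hgd : Differentiable ℂ g := by fun_prop
  have hshift : fockInner f (repKer z) = ∫ v : ℂ, g v * (omegaW v : ℂ) := by
    rw [fockInner, ← integral_add_right_eq_self _ z]
    refine integral_congr_ae (Eventually.of_forall fun v => ?_)
    simp only [hg, repKer, omegaW, mul_assoc]
    congr 1
    push_cast
    rw [← Complex.exp_conj, mul_left_comm, ← Complex.exp_add, mul_left_comm, ← Complex.exp_add,
      ← Complex.conj_mul', ← Complex.conj_mul']
    congr 2
    simp only [map_mul, map_add, Complex.conj_conj]
    ring
  rw [hshift, integral_mul_omegaW_of_entire hgd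
    (C := b * Real.pi⁻¹ * Real.exp (‖z‖ ^ 2 + (3 * ‖z‖ + 1) * ‖z‖))]
  · simp [hg]
  · intro v
    have h1 : ‖Complex.exp (-(starRingEnd ℂ z * v))‖ ≤ Real.exp (‖z‖ * ‖v‖) := by
      refine (Complex.norm_exp_le_exp_norm _).trans_eq ?_
      rw [norm_neg, norm_mul, RCLike.norm_conj]
    have hu : ‖v + z‖ ≤ ‖v‖ + ‖z‖ := norm_add_le v z
    have hl : ‖v‖ - ‖z‖ ≤ ‖v + z‖ := by
      simpa using norm_sub_norm_le v (-z)
    have hexp : ‖v + z‖ ^ 2 - (3 * ‖z‖ + 1) * ‖v + z‖ + ‖z‖ * ‖v‖ + -‖v‖ ^ 2 ≤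
        ‖z‖ ^ 2 + (3 * ‖z‖ + 1) * ‖z‖ + -‖v‖ := by
      have h2 : ‖v + z‖ ^ 2 ≤ (‖v‖ + ‖z‖) ^ 2 := by gcongr
      have h3 := mul_le_mul_of_nonneg_left hl (by positivity : 0 ≤ 3 * ‖z‖ + 1)
      nlinarith
    calc ‖g v‖ * omegaW v
        ≤ b * Real.exp (‖v + z‖ ^ 2 - (3 * ‖z‖ + 1) * ‖v + z‖) * Real.exp (‖z‖ * ‖v‖) *
          omegaW v := by
          rw [hg, norm_mul]
          have := hb (v + z)
          have := (omegaW_pos v).le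
          gcongr
      _ = b * Real.pi⁻¹ * Real.exp (‖v + z‖ ^ 2 - (3 * ‖z‖ + 1) * ‖v + z‖ + ‖z‖ * ‖v‖ +
          -‖v‖ ^ 2) := by
          rw [omegaW, Real.exp_add _ (-‖v‖ ^ 2), Real.exp_add _ (‖z‖ * ‖v‖)]
          ring
      _ ≤ b * Real.pi⁻¹ * Real.exp (‖z‖ ^ 2 + (3 * ‖z‖ + 1) * ‖z‖ + -‖v‖) := by gcongr
      _ = b * Real.pi⁻¹ * Real.exp (‖z‖ ^ 2 + (3 * ‖z‖ + 1) * ‖z‖) * Real.exp (-‖v‖) := by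
          rw [Real.exp_add _ (-‖v‖)]
          ring

lemma differentiable_dslope {f : ℂ → ℂ} (hf : Differentiable ℂ f) (c : ℂ) :
    Differentiable ℂ (dslope f c) :=
  differentiableOn_univ.mp
    ((Complex.differentiableOn_dslope univ_mem).mpr hf.differentiableOn)

lemma MemD1Minus.dslope_zero {f : ℂ → ℂ} (hf : Differentiable ℂ f) (hf' : MemD1Minus f) :
    MemD1Minus (dslope f 0) := by
  intro a ha
  obtain ⟨b, hb⟩ := hf' a ha
  obtain ⟨M, hM⟩ := (isCompact_closedBall (0 : ℂ) 1).exists_bound_of_continuousOn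
    (differentiable_dslope hf 0).continuous.continuousOn
  have hb0 : 0 ≤ b := by
    have h := (norm_nonneg _).trans (hb 0)
    exact nonneg_of_mul_nonneg_left h (Real.exp_pos _)
  have hM0 : 0 ≤ M := (norm_nonneg _).trans (hM 0 (by simp))
  have hlow : ∀ z : ℂ, 1 ≤ Real.exp (a ^ 2) * Real.exp (‖z‖ ^ 2 - a * ‖z‖) := by
    intro z
    rw [← Real.exp_add]
    exact Real.one_le_exp (by nlinarith [sq_nonneg (a - ‖z‖), sq_nonneg a, sq_nonneg ‖z‖])
  refine ⟨b + (‖f 0‖ + M) * Real.exp (a ^ 2), fun z => ?_⟩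
  have hE := Real.exp_pos (‖z‖ ^ 2 - a * ‖z‖)
  have hsum : ‖dslope f 0 z‖ ≤ b * Real.exp (‖z‖ ^ 2 - a * ‖z‖) + (‖f 0‖ + M) := by
    rcases le_or_gt ‖z‖ 1 with hz | hz
    · have := hM z (by simpa using hz)
      have := norm_nonneg (f 0)
      have := mul_nonneg hb0 hE.le
      linarith
    · have hz0 : z ≠ 0 := norm_pos_iff.mp (one_pos.trans hz)
      rw [dslope_of_ne _ hz0, slope_def_field, sub_zero, norm_div]
      calc ‖f z - f 0‖ / ‖z‖ ≤ ‖f z - f 0‖ := div_le_self (norm_nonneg _) hz.le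
        _ ≤ ‖f z‖ + ‖f 0‖ := norm_sub_le _ _
        _ ≤ _ := by linarith [hb z]
  calc ‖dslope f 0 z‖ ≤ _ := hsum
    _ ≤ b * Real.exp (‖z‖ ^ 2 - a * ‖z‖) +
        (‖f 0‖ + M) * (Real.exp (a ^ 2) * Real.exp (‖z‖ ^ 2 - a * ‖z‖)) := by
        gcongr
        exact le_mul_of_one_le_right (by positivity) (hlow z)
    _ = _ := by ring

lemma MemD1Minus.neg {f : ℂ → ℂ} (hf : MemD1Minus f) : MemD1Minus fun z => -f z := by
  simpa only [MemD1Minus, norm_neg] using hf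

lemma matP_eq (T : Dst) (k k' : ℕ) :
    matP T k k' = T fun w => w ^ k * starRingEnd ℂ w ^ k' := by
  simp only [matP, toeplitzForm, map_pow]

lemma toeplitzForm_repKer (T : Dst) (z z' : ℂ) :
    toeplitzForm T (repKer z) (repKer z') =
      T fun w => Complex.exp (w * starRingEnd ℂ z) * Complex.exp (starRingEnd ℂ w * z') := by
  simp only [toeplitzForm, repKer, ← Complex.exp_conj, map_mul, Complex.conj_conj]

/-- **The finite rank property descends through the `∂̄`-equation.** If `𝐅 = ∂̄𝐆`
with `𝐅 ∈ Λ'_{q,l}`, `𝐆 ∈ Λ'_{q',l'}`, `q, q' > 1`, then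
`𝐭_F(z^k, z^{k'}) = -k' 𝐭_G(z^k, z^{k'-1})` for `k' ≥ 1`, and if `𝐭_F` has finite
rank at most `N` on reproducing kernels then so does `𝐭_G`. -/
theorem finite_rank_descends_through_dbar
    (q q' : ℝ) (hq : 1 < q) (hq' : 1 < q') (l l' : ℕ)
    (F G : Dst) (hF : MemLambdaDual q l F) (hG : MemLambdaDual q' l' G)
    (hFG : ∀ ψ : ℂ → ℂ, MemDq (min q q') ψ → F ψ = -G (dbarFun ψ)) :
    (∀ k k' : ℕ, 1 ≤ k' → matP F k k' = -(k' : ℂ) * matP G k (k' - 1)) ∧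
    ∀ N : ℕ, FiniteRankOnKernels F N → FiniteRankOnKernels G N := by
  have hq0 : 0 < q' := zero_lt_one.trans hq'
  have hmin : 0 < min q q' := lt_min (zero_lt_one.trans hq) hq0
  refine ⟨fun k k' _ => ?_, ?_⟩
  · rw [matP_eq, matP_eq, hFG _ ((hasExpGrowth_monomial k k').memDq hmin), dbarFun_monomial,
      hG.2.1 _ _ ((hasExpGrowth_monomial k (k' - 1)).memLambda hq0 l'), neg_mul]
  · rintro N ⟨f, g, hf, hg, hrank⟩
    have hΦ : ∀ s t : ℂ, F (fun w => Complex.exp (w * s) * Complex.exp (starRingEnd ℂ w * t)) =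
        -(t * G fun w => Complex.exp (w * s) * Complex.exp (starRingEnd ℂ w * t)) := by
      intro s t
      rw [hFG _ ((hasExpGrowth_exp_mul_exp s t).memDq hmin), dbarFun_exp_mul_exp,
        hG.2.1 _ _ ((hasExpGrowth_exp_mul_exp s t).memLambda hq0 l')]
    have hdiff : ∀ j, Differentiable ℂ fun z => -dslope (f j) 0 z :=
      fun j => (differentiable_dslope (hf j).1 0).neg
    have hgrow : ∀ j, MemD1Minus fun z => -dslope (f j) 0 z :=
      fun j => ((hf j).2.dslope_zero (hf j).1).neg
    refine ⟨fun j z => -dslope (f j) 0 z, g, fun j => ⟨hdiff j, hgrow j⟩, hg, fun z z' => ?_⟩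
    simp only [fockInner_repKer (hdiff _) (hgrow _), toeplitzForm_repKer]
    have hF' : ∀ t, -(t * G fun w => Complex.exp (w * starRingEnd ℂ z) *
        Complex.exp (starRingEnd ℂ w * t)) = ∑ j, fockInner (repKer z) (g j) * f j t := by
      intro t
      rw [← hΦ, ← toeplitzForm_repKer F, hrank]
      simp only [fockInner_repKer (hf _).1 (hf _).2]
    have hne : ∀ t : ℂ, t ≠ 0 → (G fun w => Complex.exp (w * starRingEnd ℂ z) *
        Complex.exp (starRingEnd ℂ w * t)) =
          ∑ j, fockInner (repKer z) (g j) * -dslope (f j) 0 t := by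
      intro t ht
      have h0 : ∑ j, fockInner (repKer z) (g j) * f j 0 = 0 := by
        rw [← hF', zero_mul, neg_zero]
      refine mul_left_cancel₀ (neg_ne_zero.mpr ht) ?_
      rw [neg_mul, hF', ← sub_eq_self (a := ∑ j, fockInner (repKer z) (g j) * f j t) |>.mpr h0,
        ← Finset.sum_sub_distrib, Finset.mul_sum]
      refine Finset.sum_congr rfl fun j _ => ?_
      rw [dslope_of_ne _ ht, slope_def_field, sub_zero]
      field_simp
    rcases eq_or_ne z' 0 with rfl | hz'
    · have hlim := (hG.tendsto_exp_mul_exp hq' (starRingEnd ℂ z)).mono_left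
        (nhdsWithin_le_nhds (s := {0}ᶜ))
      have hcont : Continuous fun t => ∑ j, fockInner (repKer z) (g j) * -dslope (f j) 0 t :=
        continuous_finsetSum _ fun j _ => continuous_const.mul (hdiff j).continuous
      refine tendsto_nhds_unique hlim
        (((hcont.tendsto 0).mono_left nhdsWithin_le_nhds).congr' ?_)
      filter_upwards [self_mem_nhdsWithin] with t ht using (hne t ht).symm
    · exact hne z' hz'
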